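/- Let A be an algebra with Day operations m₀,…,m_n, let k ≥ 2, and T = (θ₀,…,θ_{k-1}) ∈ Con(A)^k. Then for every j < k, [T]_j = Cg(X(T)); that is, the higher commutator equals the congruence generated by the set X(T) of pivot lines of fully shift-rotated T-matrices. -/

import Mathlib

namespace UACommutator

/-- A signature: a type of operation symbols with arities. -/
structure Signature where
  ops : Type
  arity : ops → ℕ

/-- An algebra for a signature: a nonempty carrier with interpretations of the operations. -/
structure Alg (σ : Signature) where
  carrier : Type
  nonempty : Nonempty carrier
  interp : (o : σ.ops) → (Fin (σ.arity o) → carrier) → carrier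

/-- A congruence of an algebra: an equivalence relation compatible with all basic operations. -/
structure Congruence {σ : Signature} (A : Alg σ) where
  rel : A.carrier → A.carrier → Prop
  iseqv : Equivalence rel
  compat : ∀ (o : σ.ops) (x y : Fin (σ.arity o) → A.carrier),
    (∀ i, rel (x i) (y i)) → rel (A.interp o x) (A.interp o y)

instance {σ : Signature} {A : Alg σ} : LE (Congruence A) :=
  ⟨fun a b => ∀ x y, a.rel x y → b.rel x y⟩

/-- Terms of the signature with variables in `V`. -/
inductive Term (σ : Signature) (V : Type) : Type
  | var : V → Term σ V
  | app : (o : σ.ops) → (Fin (σ.arity o) → Term σ V) → Term σ V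

def Term.evalA {σ : Signature} (A : Alg σ) {V : Type} :
    Term σ V → (V → A.carrier) → A.carrier
  | .var v, env => env v
  | .app o args, env => A.interp o (fun i => (args i).evalA A env)

/-- Polynomial operations of an algebra `A` with variables in `V`:
built from variables, constants of `A`, and the basic operations. -/
inductive Poly {σ : Signature} (A : Alg σ) (V : Type) : Type
  | var : V → Poly A V
  | const : A.carrier → Poly A V
  | app : (o : σ.ops) → (Fin (σ.arity o) → Poly A V) → Poly A V

def Poly.eval {σ : Signature} {A : Alg σ} {V : Type} :
    Poly A V → (V → A.carrier) → A.carrier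
  | .var v, env => env v
  | .const c, _ => c
  | .app o args, env => A.interp o (fun i => (args i).eval env)

/-- Evaluate a polynomial whose variables are grouped into `k` tuples (tuple `i` of
length `ν i`) at the tuples `a i` (where `g i = false`) or `b i` (where `g i = true`). -/
def evalTup {σ : Signature} {A : Alg σ} {k : ℕ} {ν : Fin k → ℕ}
    (p : Poly A (Σ i, Fin (ν i))) (a b : ∀ i, Fin (ν i) → A.carrier)
    (g : Fin k → Bool) : A.carrier :=
  p.eval (fun x => if g x.1 then b x.1 x.2 else a x.1 x.2)

/-- The term condition `C(α₀,…,α_{k-1}; δ)`, centralizing at coordinate `j`. -/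
def TC {σ : Signature} {A : Alg σ} {k : ℕ} (α : Fin k → Congruence A) (j : Fin k)
    (δ : Congruence A) : Prop :=
  ∀ (ν : Fin k → ℕ) (p : Poly A (Σ i, Fin (ν i)))
    (a b : ∀ i, Fin (ν i) → A.carrier),
    (∀ i mm, (α i).rel (a i mm) (b i mm)) →
    (∀ g : Fin k → Bool, g j = false → (∃ i, i ≠ j ∧ g i = false) →
      δ.rel (evalTup p a b g) (evalTup p a b (Function.update g j true))) →
    δ.rel (evalTup p a b (Function.update (fun _ => true) j false))
          (evalTup p a b (fun _ => true))

/-- The meet (intersection) of a family of congruences. -/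
def infCong {σ : Signature} {A : Alg σ} {ι : Sort*} (ds : ι → Congruence A) :
    Congruence A where
  rel x y := ∀ i, (ds i).rel x y
  iseqv := ⟨fun x i => (ds i).iseqv.refl x,
            fun h i => (ds i).iseqv.symm (h i),
            fun h h' i => (ds i).iseqv.trans (h i) (h' i)⟩
  compat o x y h := fun i => (ds i).compat o x y (fun mm => h mm i)

/-- The higher commutator `[α₀,…,α_{k-1}]` (term-condition version), as the meet of
all congruences `δ` such that `C(α₀,…,α_{k-1}; δ)` holds, centralizing at `j`. -/
def commTC {σ : Signature} {A : Alg σ} {k : ℕ} (α : Fin k → Congruence A) (j : Fin k) :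
    Congruence A :=
  infCong (fun d : {δ : Congruence A // TC α j δ} => d.val)

/-- The congruence generated by a binary relation `X`. -/
def Cg {σ : Signature} {A : Alg σ} (X : A.carrier → A.carrier → Prop) : Congruence A :=
  infCong (fun d : {δ : Congruence A // ∀ x y, X x y → δ.rel x y} => d.val)

theorem Cg_base {σ : Signature} {A : Alg σ} (X : A.carrier → A.carrier → Prop)
    {x y : A.carrier} (h : X x y) : (Cg X).rel x y :=
  fun i => i.2 x y h

/-- The join of a family of congruences: the least congruence containing every member. -/
def supCong {σ : Signature} {A : Alg σ} {ι : Sort*} (γ : ι → Congruence A) :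
    Congruence A :=
  Cg (fun x y => ∃ i, (γ i).rel x y)

/-- The join of two congruences. -/
def joinCong {σ : Signature} {A : Alg σ} (a b : Congruence A) : Congruence A :=
  Cg (fun x y => a.rel x y ∨ b.rel x y)

/-- `m` is a `T`-matrix for `T = (θ₀,…,θ_{k-1})`. -/
def IsMatrix {σ : Signature} {A : Alg σ} {k : ℕ} (θ : Fin k → Congruence A)
    (m : (Fin k → Bool) → A.carrier) : Prop :=
  ∃ (ν : Fin k → ℕ) (p : Poly A (Σ i, Fin (ν i))) (a b : ∀ i, Fin (ν i) → A.carrier),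
    (∀ i jj, (θ i).rel (a i jj) (b i jj)) ∧
    ∀ f : Fin k → Bool, m f = evalTup p a b f

/-- The matrix centralization condition `C(T; j; δ)`: for every `T`-matrix, if every
`(j)`-supporting line is a `δ`-pair then the `(j)`-pivot line is a `δ`-pair. -/
def CMat {σ : Signature} {A : Alg σ} {k : ℕ} (θ : Fin k → Congruence A) (j : Fin k)
    (δ : Congruence A) : Prop :=
  ∀ m : (Fin k → Bool) → A.carrier, IsMatrix θ m →
    (∀ g : Fin k → Bool, (∃ i, i ≠ j ∧ g i = false) →
      δ.rel (m (Function.update g j false)) (m (Function.update g j true))) →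
    δ.rel (m (Function.update (fun _ => true) j false)) (m (fun _ => true))

/-- `[T]_j`: the meet of all congruences `δ` with `C(T; j; δ)`. -/
def commMat {σ : Signature} {A : Alg σ} {k : ℕ} (θ : Fin k → Congruence A) (j : Fin k) :
    Congruence A :=
  infCong (fun d : {δ : Congruence A // CMat θ j δ} => d.val)

/-- Day operations `m₀, …, m_n` for an algebra, each induced by a term of the signature. -/
structure DayOps {σ : Signature} (A : Alg σ) (n : ℕ) where
  m : Fin (n+1) → A.carrier → A.carrier → A.carrier → A.carrier → A.carrier
  isTerm : ∀ e, ∃ t : Term σ (Fin 4), ∀ x y z u, m e x y z u = t.evalA A ![x, y, z, u]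
  idem : ∀ e x y, m e x y y x = x
  first : ∀ x y z u, m 0 x y z u = x
  last : ∀ x y z u, m (Fin.last n) x y z u = u
  even : ∀ (e : ℕ) (he : e < n), Even e → ∀ x u,
    m ⟨e, by omega⟩ x x u u = m ⟨e+1, by omega⟩ x x u u
  odd : ∀ (e : ℕ) (he : e < n), Odd e → ∀ x y u,
    m ⟨e, by omega⟩ x y y u = m ⟨e+1, by omega⟩ x y y u

/-- The `e`-th shift rotation at `(j, l)` of a cube `h`. -/
def shiftRot {σ : Signature} {A : Alg σ} {n k : ℕ} (D : DayOps A n) (e : Fin (n+1))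
    (j l : Fin k) (h : (Fin k → Bool) → A.carrier) :
    (Fin k → Bool) → A.carrier := fun f =>
  let r := h (Function.update (Function.update f j false) l false)
  let s := h (Function.update (Function.update f j false) l true)
  let u := h (Function.update (Function.update f j true) l false)
  let v := h (Function.update (Function.update f j true) l true)
  if f j then (if f l then D.m e s s v v else D.m e s r u v) else s

/-- `hIter D m hm d h` is `h^{(d₀,…,d_{m-1})}`: the result of applying the shift
rotations `R^{d₀}_{0,1}, …, R^{d_{m-1}}_{m-1,m}` successively to `h`. -/
def hIter {σ : Signature} {A : Alg σ} {n k : ℕ} (D : DayOps A n) :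
    (m : ℕ) → m < k → (Fin m → Fin (n+1)) → ((Fin k → Bool) → A.carrier) →
    ((Fin k → Bool) → A.carrier)
  | 0, _, _, h => h
  | (m+1), hm, d, h =>
      shiftRot D (d (Fin.last m)) ⟨m, by omega⟩ ⟨m+1, hm⟩
        (hIter D m (by omega) (fun i => d i.castSucc) h)

/-- `X(T)`: the set of `(k-1)`-pivot lines of the matrices `h^d`, over all `T`-matrices
`h` and all `d ∈ {0,…,n}^{k-1}`. -/
def XSet {σ : Signature} {A : Alg σ} {n k : ℕ} (hk : 0 < k) (D : DayOps A n)
    (θ : Fin k → Congruence A) : A.carrier → A.carrier → Prop :=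
  fun x y => ∃ h : (Fin k → Bool) → A.carrier, IsMatrix θ h ∧
    ∃ d : Fin (k-1) → Fin (n+1),
      x = hIter D (k-1) (by omega) d h
            (Function.update (fun _ => true) (⟨k-1, by omega⟩ : Fin k) false) ∧
      y = hIter D (k-1) (by omega) d h (fun _ => true)

/-- Product algebra `A^I` with pointwise operations. -/
def prodAlg {σ : Signature} (A : Alg σ) (I : Type) : Alg σ where
  carrier := I → A.carrier
  nonempty := ⟨fun _ => Classical.choice A.nonempty⟩
  interp o x := fun i => A.interp o (fun mm => x mm i)

/-- Membership in the subalgebra of `B` generated by a set `S`. -/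
inductive Gen {σ : Signature} (B : Alg σ) (S : Set B.carrier) : B.carrier → Prop
  | base : ∀ x ∈ S, Gen B S x
  | app : ∀ (o : σ.ops) (x : Fin (σ.arity o) → B.carrier),
      (∀ i, Gen B S (x i)) → Gen B S (B.interp o x)

/-- `f : A → B` is a homomorphism. -/
def IsHom {σ : Signature} (A B : Alg σ) (f : A.carrier → B.carrier) : Prop :=
  ∀ (o : σ.ops) (x : Fin (σ.arity o) → A.carrier),
    f (A.interp o x) = B.interp o (fun i => f (x i))

/-- The kernel congruence of a homomorphism. -/
def kerCong {σ : Signature} {A B : Alg σ} (f : A.carrier → B.carrier)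
    (hf : IsHom A B f) : Congruence A where
  rel x y := f x = f y
  iseqv := ⟨fun _ => rfl, Eq.symm, Eq.trans⟩
  compat o x y h := by
    show f (A.interp o x) = f (A.interp o y)
    rw [hf o x, hf o y]
    congr 1
    funext i
    exact h i

/-- The image `f(γ)` of a congruence `γ ≥ ker f` under a surjective homomorphism `f`. -/
def mapCong {σ : Signature} {A B : Alg σ} (f : A.carrier → B.carrier)
    (hf : IsHom A B f) (hs : Function.Surjective f) (γ : Congruence A)
    (hγ : ∀ x y, f x = f y → γ.rel x y) : Congruence B where
  rel u v := ∃ x y, γ.rel x y ∧ f x = u ∧ f y = v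
  iseqv := by
    refine ⟨?_, ?_, ?_⟩
    · intro u
      obtain ⟨x, hx⟩ := hs u
      exact ⟨x, x, γ.iseqv.refl x, hx, hx⟩
    · rintro u v ⟨x, y, hxy, hx, hy⟩
      exact ⟨y, x, γ.iseqv.symm hxy, hy, hx⟩
    · rintro u v w ⟨x, y, hxy, hx, hy⟩ ⟨y', z, hyz, hy', hz⟩
      exact ⟨x, z, γ.iseqv.trans hxy (γ.iseqv.trans (hγ y y' (hy.trans hy'.symm)) hyz),
        hx, hz⟩
  compat o u v h := by
    choose x y hxy hx hy using h
    refine ⟨A.interp o x, A.interp o y, γ.compat o x y hxy, ?_, ?_⟩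
    · rw [hf o x]
      congr 1
      funext i
      exact hx i
    · rw [hf o y]
      congr 1
      funext i
      exact hy i

/-- The preimage `f⁻¹(β)` of a congruence of `B` under a homomorphism `f`. -/
def comapCong {σ : Signature} {A B : Alg σ} (f : A.carrier → B.carrier)
    (hf : IsHom A B f) (β : Congruence B) : Congruence A where
  rel x y := β.rel (f x) (f y)
  iseqv := ⟨fun _ => β.iseqv.refl _, β.iseqv.symm, β.iseqv.trans⟩
  compat o x y h := by
    show β.rel (f (A.interp o x)) (f (A.interp o y))
    rw [hf o x, hf o y]
    exact β.compat o _ _ h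

theorem Congruence.eq_of_rel_iff {σ : Signature} {A : Alg σ} {α β : Congruence A}
    (h : ∀ x y, α.rel x y ↔ β.rel x y) : α = β := by
  have hrel : α.rel = β.rel := by
    funext x y
    exact propext (h x y)
  cases α
  cases β
  cases hrel
  rfl

theorem Congruence.rel_evalA {σ : Signature} {A : Alg σ} (δ : Congruence A) {V : Type}
    (t : Term σ V) {x y : V → A.carrier} (h : ∀ v, δ.rel (x v) (y v)) :
    δ.rel (t.evalA A x) (t.evalA A y) := by
  induction t with
  | var v => exact h v
  | app o args ih => exact δ.compat o _ _ ih

theorem DayOps.rel_m {σ : Signature} {A : Alg σ} {n : ℕ} (D : DayOps A n) (δ : Congruence A)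
    (e : Fin (n + 1)) {x y z u x' y' z' u' : A.carrier} (hx : δ.rel x x') (hy : δ.rel y y')
    (hz : δ.rel z z') (hu : δ.rel u u') : δ.rel (D.m e x y z u) (D.m e x' y' z' u') := by
  obtain ⟨t, ht⟩ := D.isTerm e
  rw [ht, ht]
  refine δ.rel_evalA t fun v => ?_
  fin_cases v
  exacts [hx, hy, hz, hu]

/-- Transfer of a congruence pair from one side of a square to the opposite one. -/
theorem DayOps.rel_of_forall {σ : Signature} {A : Alg σ} {n : ℕ} (D : DayOps A n)
    (δ : Congruence A) {r s u v : A.carrier} (hru : δ.rel r u)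
    (h : ∀ e, δ.rel (D.m e s r u v) (D.m e s s v v)) : δ.rel s v := by
  have key : ∀ (e : ℕ) (he : e < n + 1), δ.rel s (D.m ⟨e, he⟩ s s v v) := by
    intro e
    induction e with
    | zero =>
      intro he
      have h0 : D.m ⟨0, he⟩ s s v v = s := D.first s s v v
      rw [h0]
      exact δ.iseqv.refl s
    | succ e ih =>
      intro he
      have hs := ih (by omega)
      rcases Nat.even_or_odd e with hev | hodd
      · rwa [D.even e (by omega) hev s v] at hs
      · have hr : ∀ i, δ.rel (D.m i s r u v) (D.m i s r r v) := fun i =>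
          D.rel_m δ i (δ.iseqv.refl s) (δ.iseqv.refl r) (δ.iseqv.symm hru) (δ.iseqv.refl v)
        have hmid := δ.iseqv.trans (δ.iseqv.symm (h ⟨e, by omega⟩)) (hr ⟨e, by omega⟩)
        rw [D.odd e (by omega) hodd s r v] at hmid
        exact δ.iseqv.trans hs (δ.iseqv.trans hmid
          (δ.iseqv.trans (δ.iseqv.symm (hr ⟨e + 1, he⟩)) (h ⟨e + 1, he⟩)))
  have hn := key n (by omega)
  have hl : D.m ⟨n, by omega⟩ s s v v = v := D.last s s v v
  rwa [hl] at hn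

/-- Renaming the variables of a polynomial. -/
def Poly.rename {σ : Signature} {A : Alg σ} {V W : Type} (φ : V → W) : Poly A V → Poly A W
  | .var v => .var (φ v)
  | .const c => .const c
  | .app o args => .app o (fun i => (args i).rename φ)

theorem Poly.eval_rename {σ : Signature} {A : Alg σ} {V W : Type} (φ : V → W) (p : Poly A V)
    (env : W → A.carrier) : (p.rename φ).eval env = p.eval (env ∘ φ) := by
  induction p with
  | var v => rfl
  | const c => rfl
  | app o args ih => exact congrArg (A.interp o) (funext ih)

/-- Substituting polynomials for the variables of a term. -/
def Term.bindPoly {σ : Signature} {A : Alg σ} {V W : Type} (φ : V → Poly A W) :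
    Term σ V → Poly A W
  | .var v => φ v
  | .app o args => .app o (fun i => (args i).bindPoly φ)

theorem Term.eval_bindPoly {σ : Signature} {A : Alg σ} {V W : Type} (φ : V → Poly A W)
    (t : Term σ V) (env : W → A.carrier) :
    (t.bindPoly φ).eval env = t.evalA A (fun v => (φ v).eval env) := by
  induction t with
  | var v => rfl
  | app o args ih => exact congrArg (A.interp o) (funext ih)

/-- Matrices are closed under applying a term to copies of a matrix whose coordinates have been
reindexed independently of each other. -/
theorem IsMatrix.evalA {σ : Signature} {A : Alg σ} {k q : ℕ} {θ : Fin k → Congruence A}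
    {h : (Fin k → Bool) → A.carrier} (hh : IsMatrix θ h) (t : Term σ (Fin q))
    (φ ψ : Fin q → Fin k → Bool) :
    IsMatrix θ (fun f => t.evalA A (fun c => h (fun i => if f i then ψ c i else φ c i))) := by
  obtain ⟨ν, p, a, b, hab, hp⟩ := hh
  let pick (χ : Fin q → Fin k → Bool) (i : Fin k) (x : Fin (q * ν i)) : A.carrier :=
    if χ (finProdFinEquiv.symm x).1 i then b i (finProdFinEquiv.symm x).2
    else a i (finProdFinEquiv.symm x).2
  refine ⟨fun i => q * ν i,
    t.bindPoly fun c => p.rename fun x => ⟨x.1, finProdFinEquiv (c, x.2)⟩,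
    pick φ, pick ψ, fun i x => ?_, fun f => ?_⟩
  · simp only [pick]
    split_ifs
    exacts [(θ i).iseqv.refl _, (θ i).iseqv.symm (hab i _), hab i _, (θ i).iseqv.refl _]
  · simp only [evalTup, Term.eval_bindPoly, Poly.eval_rename]
    congr 1
    funext c
    rw [hp, evalTup]
    congr 1
    funext x
    simp only [pick, Function.comp, Equiv.symm_apply_apply]
    cases f x.1 <;> simp

theorem IsMatrix.shiftRot {σ : Signature} {A : Alg σ} {n k : ℕ} {θ : Fin k → Congruence A}
    {h : (Fin k → Bool) → A.carrier} (hh : IsMatrix θ h) (D : DayOps A n) (e : Fin (n + 1))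
    {j l : Fin k} (hjl : j ≠ l) : IsMatrix θ (shiftRot D e j l h) := by
  obtain ⟨t, ht⟩ := D.isTerm e
  have key := hh.evalA t
    ![fun i => decide (i = l), fun _ => false, fun _ => false, fun i => decide (i = l)]
    ![fun i => decide (i ≠ j), fun i => decide (i ≠ j), fun _ => true, fun _ => true]
  convert key using 1
  funext f
  have hx : (fun i => if f i then decide (i ≠ j) else decide (i = l)) =
      Function.update (Function.update f j false) l true := by
    funext i
    by_cases hl : i = l
    · subst hl
      simp [hjl.symm]
    · by_cases hj : i = j <;> simp [hl, hj, hjl]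
  have hy : (fun i => if f i then decide (i ≠ j) else false) = Function.update f j false := by
    funext i
    by_cases hj : i = j <;> simp [hj]
  have hz : (fun i => if f i then true else false) = f := by
    funext i
    simp
  have hw : (fun i => if f i then true else decide (i = l)) = Function.update f l true := by
    funext i
    by_cases hl : i = l <;> simp [hl]
  have hrhs : t.evalA A (fun c => h (fun i => if f i then
        (![fun i => decide (i ≠ j), fun i => decide (i ≠ j), fun _ => true, fun _ => true] :
          Fin 4 → Fin k → Bool) c i
      else (![fun i => decide (i = l), fun _ => false, fun _ => false, fun i => decide (i = l)] :
          Fin 4 → Fin k → Bool) c i)) =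
      D.m e (h (Function.update (Function.update f j false) l true))
        (h (Function.update f j false)) (h f) (h (Function.update f l true)) := by
    rw [ht, ← hx, ← hy, ← hw]
    conv_rhs => rw [← hz]
    congr 1
    funext c
    fin_cases c <;> simp
  rw [hrhs]
  cases hj : f j <;> cases hl : f l <;>
    have hj' := hj ▸ Function.update_eq_self j f <;>
    have hl' := hl ▸ Function.update_eq_self l f <;>
    simp only [UACommutator.shiftRot, hj, hl, Function.update_comm hjl, hj', hl', D.idem, if_true,
      Bool.false_eq_true, if_false]

section ShiftRotation

variable {σ : Signature} {A : Alg σ} {n k : ℕ} (D : DayOps A n) (e : Fin (n + 1)) {j l : Fin k}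
  (h : (Fin k → Bool) → A.carrier) (g : Fin k → Bool)

theorem shiftRot_of_eq_false (hjl : j ≠ l) (hg : g j = false) (ε : Bool) :
    shiftRot D e j l h (Function.update g l ε) = h (Function.update g l true) := by
  have hj : Function.update (Function.update g l true) j false = Function.update g l true := by
    rw [Function.update_eq_self_iff, Function.update_of_ne hjl, hg]
  simp [shiftRot, hjl, hg, Function.update_comm hjl, hj]

theorem shiftRot_update_false (hjl : j ≠ l) (hg : g j = true) :
    shiftRot D e j l h (Function.update g l false) =
      D.m e (h (Function.update (Function.update g l true) j false))
        (h (Function.update (Function.update g l false) j false))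
        (h (Function.update (Function.update g l false) j true))
        (h (Function.update (Function.update g l true) j true)) := by
  simp [shiftRot, hjl, hg, Function.update_comm hjl]

theorem shiftRot_update_true (hjl : j ≠ l) (hg : g j = true) :
    shiftRot D e j l h (Function.update g l true) =
      D.m e (h (Function.update (Function.update g l true) j false))
        (h (Function.update (Function.update g l true) j false))
        (h (Function.update (Function.update g l true) j true))
        (h (Function.update (Function.update g l true) j true)) := by
  simp [shiftRot, hjl, hg, Function.update_comm hjl]

/-- If the `(j)`-lines of `h` outside the face where `P` is constantly `true` are `δ`-pairs, then
the `(l)`-lines of its shift rotation outside the face where `P ∪ {j}` is constantly `true` are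
`δ`-pairs. -/
theorem rel_shiftRot_line (δ : Congruence A) (hjl : j ≠ l) (P : Fin k → Prop)
    (hP : ∀ g : Fin k → Bool, (∃ i, P i ∧ g i = false) →
      δ.rel (h (Function.update g j false)) (h (Function.update g j true)))
    (hg : ∃ i, i ≠ l ∧ (i = j ∨ P i) ∧ g i = false) :
    δ.rel (shiftRot D e j l h (Function.update g l false))
      (shiftRot D e j l h (Function.update g l true)) := by
  cases hgj : g j with
  | false =>
    rw [shiftRot_of_eq_false D e h g hjl hgj, shiftRot_of_eq_false D e h g hjl hgj]
    exact δ.iseqv.refl _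
  | true =>
    rw [shiftRot_update_false D e h g hjl hgj, shiftRot_update_true D e h g hjl hgj]
    obtain ⟨i, hil, hi, hgi⟩ := hg
    have hPi : P i := hi.resolve_left (by rintro rfl; simp [hgj] at hgi)
    have hline : ∀ ε, δ.rel (h (Function.update (Function.update g l ε) j false))
        (h (Function.update (Function.update g l ε) j true)) := fun ε =>
      hP _ ⟨i, hPi, by rw [Function.update_of_ne hil, hgi]⟩
    have collapse : ∀ {r s u v : A.carrier}, δ.rel r u → δ.rel s v →
        δ.rel (D.m e s r u v) s := fun {r s u v} hru hsv => by
      have := D.rel_m δ e (δ.iseqv.refl s) (δ.iseqv.refl r) (δ.iseqv.symm hru) (δ.iseqv.symm hsv)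
      rwa [D.idem] at this
    exact δ.iseqv.trans (collapse (hline false) (hline true))
      (δ.iseqv.symm (collapse (hline true) (hline true)))

/-- The `(l)`-supporting lines of a shift rotation of `h` are `δ`-pairs when the `(j)`-supporting
lines of `h` are. -/
theorem rel_shiftRot_supporting (δ : Congruence A) (hjl : j ≠ l)
    (hs : ∀ g : Fin k → Bool, (∃ i, i ≠ j ∧ g i = false) →
      δ.rel (h (Function.update g j false)) (h (Function.update g j true)))
    (hg : ∃ i, i ≠ l ∧ g i = false) :
    δ.rel (shiftRot D e j l h (Function.update g l false))
      (shiftRot D e j l h (Function.update g l true)) := by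
  obtain ⟨i, hil, hgi⟩ := hg
  exact rel_shiftRot_line D e h g δ hjl (· ≠ j) hs ⟨i, hil, em _, hgi⟩

/-- The `(j)`-pivot line of `h` is a `δ`-pair if the `(l)`-pivot lines of all its shift rotations
are, provided its `(j)`-supporting lines are `δ`-pairs. -/
theorem rel_pivot_of_shiftRot (δ : Congruence A) (hjl : j ≠ l)
    (hs : ∀ g : Fin k → Bool, (∃ i, i ≠ j ∧ g i = false) →
      δ.rel (h (Function.update g j false)) (h (Function.update g j true)))
    (hp : ∀ e, δ.rel (shiftRot D e j l h (Function.update (fun _ => true) l false))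
      (shiftRot D e j l h (fun _ => true))) :
    δ.rel (h (Function.update (fun _ => true) j false)) (h (fun _ => true)) := by
  have htop : ∀ i : Fin k, Function.update (fun _ => true) i true = fun _ : Fin k => true :=
    fun i => Function.update_eq_self i _
  refine D.rel_of_forall δ (hs (Function.update (fun _ => true) l false) ⟨l, hjl.symm, by simp⟩)
    fun e => ?_
  have he := hp e
  rw [← htop l, shiftRot_update_true D e h _ hjl rfl] at he
  rw [htop l, shiftRot_update_false D e h _ hjl rfl] at he
  simpa only [htop] using he

end ShiftRotation

theorem CMat.of_ne {σ : Signature} {A : Alg σ} {n k : ℕ} (D : DayOps A n)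
    {θ : Fin k → Congruence A} {δ : Congruence A} {j l : Fin k} (hjl : j ≠ l)
    (hl : CMat θ l δ) : CMat θ j δ := fun h hh hs =>
  rel_pivot_of_shiftRot D h δ hjl hs fun e =>
    hl _ (hh.shiftRot D e hjl) fun g hg => rel_shiftRot_supporting D e h g δ hjl hs hg

theorem CMat.of_index {σ : Signature} {A : Alg σ} {n k : ℕ} (D : DayOps A n)
    {θ : Fin k → Congruence A} {δ : Congruence A} {l : Fin k} (hl : CMat θ l δ) (j : Fin k) :
    CMat θ j δ := by
  by_cases hjl : j = l
  · exact hjl ▸ hl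
  · exact hl.of_ne D hjl

theorem IsMatrix.hIter {σ : Signature} {A : Alg σ} {n k : ℕ} {θ : Fin k → Congruence A}
    {h : (Fin k → Bool) → A.carrier} (hh : IsMatrix θ h) (D : DayOps A n) :
    ∀ (m : ℕ) (hm : m < k) (d : Fin m → Fin (n + 1)), IsMatrix θ (hIter D m hm d h)
  | 0, _, _ => hh
  | m + 1, _, _ => (hh.hIter D m _ _).shiftRot D _ (by simp)

theorem rel_hIter_line {σ : Signature} {A : Alg σ} {n k : ℕ} (D : DayOps A n)
    (δ : Congruence A) (h : (Fin k → Bool) → A.carrier) :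
    ∀ (m : ℕ) (hm : m < k) (d : Fin m → Fin (n + 1)) (g : Fin k → Bool),
      (∃ i : Fin k, i.val < m ∧ g i = false) →
      δ.rel (hIter D m hm d h (Function.update g ⟨m, hm⟩ false))
        (hIter D m hm d h (Function.update g ⟨m, hm⟩ true))
  | 0, _, _, _, ⟨_, hi, _⟩ => absurd hi (Nat.not_lt_zero _)
  | m + 1, hm, _, g, ⟨i, hi, hgi⟩ =>
    rel_shiftRot_line D _ _ g δ (by simp) (fun i => i.val < m)
      (rel_hIter_line D δ h m _ _)
      ⟨i, by rintro rfl; simp at hi, by rw [Fin.ext_iff]; change i.val = m ∨ _; omega, hgi⟩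

theorem rel_pivot_of_hIter {σ : Signature} {A : Alg σ} {n k : ℕ} (D : DayOps A n)
    (δ : Congruence A) (hk : 0 < k) (h : (Fin k → Bool) → A.carrier)
    (hs : ∀ g : Fin k → Bool, (∃ i, i ≠ ⟨0, hk⟩ ∧ g i = false) →
      δ.rel (h (Function.update g ⟨0, hk⟩ false)) (h (Function.update g ⟨0, hk⟩ true)))
    (m : ℕ) (hm : m < k)
    (hp : ∀ d : Fin m → Fin (n + 1),
      δ.rel (hIter D m hm d h (Function.update (fun _ => true) ⟨m, hm⟩ false))
        (hIter D m hm d h (fun _ => true))) :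
    δ.rel (h (Function.update (fun _ => true) ⟨0, hk⟩ false)) (h (fun _ => true)) := by
  have supp : ∀ (m : ℕ) (hm : m < k) (d : Fin m → Fin (n + 1)) (g : Fin k → Bool),
      (∃ i, i ≠ ⟨m, hm⟩ ∧ g i = false) →
      δ.rel (hIter D m hm d h (Function.update g ⟨m, hm⟩ false))
        (hIter D m hm d h (Function.update g ⟨m, hm⟩ true)) := by
    intro m
    induction m with
    | zero => exact fun _ _ => hs
    | succ m ih =>
      exact fun hm d g hg => rel_shiftRot_supporting D _ _ g δ (by simp) (ih (by omega) _) hg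
  induction m with
  | zero => exact hp Fin.elim0
  | succ m ih =>
    refine ih (by omega) fun d => rel_pivot_of_shiftRot D _ δ (l := ⟨m + 1, hm⟩) (by simp)
      (supp m (by omega) d) fun e => ?_
    simpa [hIter] using hp (Fin.snoc d e)

theorem CMat.rel_of_XSet {σ : Signature} {A : Alg σ} {n k : ℕ} (D : DayOps A n) (hk : 0 < k)
    {θ : Fin k → Congruence A} {δ : Congruence A} {j : Fin k} (hj : CMat θ j δ)
    {x y : A.carrier} (hxy : XSet hk D θ x y) : δ.rel x y := by
  obtain ⟨h, hh, d, rfl, rfl⟩ := hxy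
  refine hj.of_index D ⟨k - 1, by omega⟩ _ (hh.hIter D _ _ d) fun g ⟨i, hi, hgi⟩ =>
    rel_hIter_line D δ h _ _ d g ⟨i, ?_, hgi⟩
  rw [Ne, Fin.ext_iff] at hi
  change i.val ≠ k - 1 at hi
  omega

theorem CMat_Cg_XSet {σ : Signature} {A : Alg σ} {n k : ℕ} (D : DayOps A n) (hk : 0 < k)
    (θ : Fin k → Congruence A) (j : Fin k) : CMat θ j (Cg (XSet hk D θ)) := by
  have h0 : CMat θ ⟨0, hk⟩ (Cg (XSet hk D θ)) := fun h hh hs =>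
    rel_pivot_of_hIter D _ hk h hs (k - 1) (by omega) fun d =>
      Cg_base _ ⟨h, hh, d, rfl, rfl⟩
  exact h0.of_index D j

theorem commMat_eq_CgXSet {σ : Signature} (A : Alg σ) (n : ℕ)
    (D : DayOps A n) (k : ℕ) (hk : 2 ≤ k) (θ : Fin k → Congruence A) :
    ∀ j : Fin k, commMat θ j = Cg (XSet (by omega : 0 < k) D θ) := by
  intro j
  refine Congruence.eq_of_rel_iff fun x y => ⟨fun hxy => ?_, fun hxy d => ?_⟩
  · exact hxy ⟨_, CMat_Cg_XSet D _ θ j⟩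
  · exact hxy ⟨d.1, fun _ _ h => d.2.rel_of_XSet D _ h⟩

end UACommutator
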